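/- Assume sin(τ) ≠ 0. Let x, y, θ, φ, vₛ, vᵣ, p₁, p₂ be a solution of the singular system on an open interval I containing 0 such that (p₁(t), p₂(t)) ≠ (0, 0) for every t ∈ I. Then (vₛ(t)² + vᵣ(t)²)·p₁(t) = 0 holds for all t ∈ I if and only if vₛ(0) = 0 and at least one of the following holds: (a) p₁(0) = 0; (b) vᵣ(0) = 0 and cos(θ(0)) = 0. -/

import Mathlib

open Real Set

/-- A solution of the reduced ODE system governing the D-singular constrained variational
trajectories of a disc (mass `m`, radius `R`, spinning inertia `Js`, rolling inertia `Jr`)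
rolling without slip on a plane inclined at angle `τ`, on a set `I ⊆ ℝ`. -/
def IsSingularSolution (m g R Js Jr τ : ℝ) (I : Set ℝ)
    (x y θ φ vs vr p₁ p₂ : ℝ → ℝ) : Prop :=
  ∀ t ∈ I,
    HasDerivAt x (R * Real.cos (θ t) * vr t / Real.sqrt (Jr + m * R ^ 2)) t ∧
    HasDerivAt y (R * Real.sin (θ t) * vr t / Real.sqrt (Jr + m * R ^ 2)) t ∧
    HasDerivAt θ (vs t / Real.sqrt Js) t ∧
    HasDerivAt φ (vr t / Real.sqrt (Jr + m * R ^ 2)) t ∧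
    HasDerivAt vs 0 t ∧
    HasDerivAt vr (m * g * R * Real.sin τ * Real.cos (θ t) / Real.sqrt (Jr + m * R ^ 2)) t ∧
    HasDerivAt p₁
      (Real.sqrt Jr * vs t * p₂ t / (Real.sqrt Js * Real.sqrt (Jr + m * R ^ 2))) t ∧
    HasDerivAt p₂
      (-(Real.sqrt Jr * vs t * p₁ t) / (Real.sqrt Js * Real.sqrt (Jr + m * R ^ 2))) t

/-- If `u * w` vanishes near `t` and `w` is continuous and nonzero at `t`, then `u` has zero
derivative at `t`. -/
theorem HasDerivAt.eq_zero_of_eventually_mul_eq_zero {u w : ℝ → ℝ} {u' t : ℝ}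
    (hu : HasDerivAt u u' t) (hw : ContinuousAt w t) (hwt : w t ≠ 0)
    (h : ∀ᶠ s in nhds t, u s * w s = 0) : u' = 0 := by
  have hu0 : u =ᶠ[nhds t] fun _ => (0 : ℝ) := by
    filter_upwards [h, hw.eventually_ne hwt] with s hs hws
    exact (mul_eq_zero.mp hs).resolve_right hws
  exact hu.unique ((hasDerivAt_const t (0 : ℝ)).congr_of_eventuallyEq hu0)

/-- A function with zero derivative on an open interval is constant there. -/
theorem eq_of_hasDerivAt_zero_Ioo {f : ℝ → ℝ} {a b s t : ℝ}
    (hf : ∀ r ∈ Set.Ioo a b, HasDerivAt f 0 r) (hs : s ∈ Set.Ioo a b) (ht : t ∈ Set.Ioo a b) :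
    f s = f t :=
  isOpen_Ioo.is_const_of_deriv_eq_zero isPreconnected_Ioo
    (fun r hr => (hf r hr).differentiableAt.differentiableWithinAt)
    (fun r hr => (hf r hr).deriv) hs ht

theorem singular_classification_inclined (m g R Js Jr τ : ℝ)
    (hm : 0 < m) (hg : 0 < g) (hR : 0 < R) (hJs : 0 < Js) (hJr : 0 < Jr)
    (a b : ℝ) (hI : (0 : ℝ) ∈ Set.Ioo a b)
    (x y θ φ vs vr p₁ p₂ : ℝ → ℝ)
    (hsol : IsSingularSolution m g R Js Jr τ (Set.Ioo a b) x y θ φ vs vr p₁ p₂)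
    (hτ : Real.sin τ ≠ 0) (hnz : ∀ t ∈ Set.Ioo a b, (p₁ t, p₂ t) ≠ (0, 0))
    : (∀ t ∈ Set.Ioo a b, (vs t ^ 2 + vr t ^ 2) * p₁ t = 0) ↔
      (vs 0 = 0 ∧ (p₁ 0 = 0 ∨ (vr 0 = 0 ∧ Real.cos (θ 0) = 0))) := by
  have hα : Real.sqrt (Jr + m * R ^ 2) ≠ 0 := by positivity
  have hs : Real.sqrt Js ≠ 0 := by positivity
  have hr : Real.sqrt Jr ≠ 0 := by positivity
  constructor
  · intro h
    obtain ⟨-, -, -, -, hvs, hvr, hp₁, -⟩ := hsol 0 hI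
    have hev : ∀ᶠ t in nhds (0 : ℝ), (vs t ^ 2 + vr t ^ 2) * p₁ t = 0 :=
      Filter.mem_of_superset (Ioo_mem_nhds hI.1 hI.2) h
    have hvs0 : vs 0 = 0 := by
      by_contra hne
      have hpos : vs 0 ^ 2 + vr 0 ^ 2 ≠ 0 := by positivity
      have hp₁0 : p₁ 0 = 0 := (mul_eq_zero.mp (h 0 hI)).resolve_left hpos
      have hp₂0 := hp₁.eq_zero_of_eventually_mul_eq_zero
        ((hvs.continuousAt.pow 2).add (hvr.continuousAt.pow 2)) hpos
        (hev.mono fun t ht => by rw [mul_comm]; exact ht)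
      have : p₂ 0 = 0 := by simpa [hα, hs, hr, hne] using hp₂0
      exact hnz 0 hI (by rw [hp₁0, this])
    refine ⟨hvs0, or_iff_not_imp_left.mpr fun hne => ⟨?_, ?_⟩⟩
    · simpa [hvs0, hne] using h 0 hI
    · have hcos := hvr.eq_zero_of_eventually_mul_eq_zero hp₁.continuousAt hne
        (hev.mono fun t ht => by
          rcases mul_eq_zero.mp ht with h0 | h0
          · have : vr t = 0 := by nlinarith [sq_nonneg (vs t), sq_nonneg (vr t)]
            rw [this, zero_mul]
          · rw [h0, mul_zero])
      simpa [hα, hm.ne', hg.ne', hR.ne', hτ] using hcos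
  · rintro ⟨hvs0, h⟩ t ht
    have hvs : ∀ s ∈ Set.Ioo a b, vs s = 0 := fun s hs' =>
      (eq_of_hasDerivAt_zero_Ioo (fun r hr' => (hsol r hr').2.2.2.2.1) hs' hI).trans hvs0
    rcases h with hp | ⟨hvr0, hcos⟩
    · have hp₁ : p₁ t = p₁ 0 := eq_of_hasDerivAt_zero_Ioo (fun r hr' => by
        simpa [hvs r hr'] using (hsol r hr').2.2.2.2.2.2.1) ht hI
      rw [hp₁, hp, mul_zero]
    · have hθ : ∀ s ∈ Set.Ioo a b, θ s = θ 0 := fun s hs' =>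
        eq_of_hasDerivAt_zero_Ioo (fun r hr' => by
          simpa [hvs r hr'] using (hsol r hr').2.2.1) hs' hI
      have hvr : vr t = vr 0 := eq_of_hasDerivAt_zero_Ioo (fun r hr' => by
        simpa [hθ r hr', hcos] using (hsol r hr').2.2.2.2.2.1) ht hI
      simp [hvs t ht, hvr, hvr0]
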